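/- arXiv:2111.05613 — 2 statements merged into one kernel-verified Lean document; each statement's English description precedes it below -/
import Mathlib

section
/- Let M be a nondeterministic finite automaton over alphabet α with state type σ, and let r₁ and r₂ be equivalence relations (Setoids) on σ such that r₁ is finer than r₂ (whenever r₁ relates q and q', so does r₂). Then the language of the quotient automaton M/r₁ is contained in the language of the quotient automaton M/r₂. -/
/-- The quotient (merged) automaton of an NFA `M` by an equivalence relation `r`
on its states. -/
def NFA.quotient {α σ : Type*} (M : NFA α σ) (r : Setoid σ) : NFA α (Quotient r) where
  step x a := {y | ∃ q q', Quotient.mk r q = x ∧ y = Quotient.mk r q' ∧ q' ∈ M.step q a}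
  start := Quotient.mk r '' M.start
  accept := Quotient.mk r '' M.accept

/-- Merging with respect to a coarser equivalence yields a more permissive
automaton: if `r₁` is finer than `r₂`, then the language of `M/r₁` is contained
in the language of `M/r₂`. -/
theorem quotient_accepts_mono {α σ : Type*} (M : NFA α σ) (r₁ r₂ : Setoid σ)
    (h : ∀ q q' : σ, r₁.r q q' → r₂.r q q') :
    (M.quotient r₁).accepts ≤ (M.quotient r₂).accepts := by
  have key : ∀ (x : List α) (S : Set (Quotient r₁)) (T : Set (Quotient r₂)),
      (∀ q, Quotient.mk r₁ q ∈ S → Quotient.mk r₂ q ∈ T) →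
      ∀ q, Quotient.mk r₁ q ∈ (M.quotient r₁).evalFrom S x →
        Quotient.mk r₂ q ∈ (M.quotient r₂).evalFrom T x := by
    intro x
    induction x with
    | nil => intro S T hST q hq; exact hST q hq
    | cons a x ih =>
      intro S T hST
      rw [NFA.evalFrom_cons, NFA.evalFrom_cons]
      apply ih
      intro q hq
      rw [NFA.mem_stepSet] at hq ⊢
      obtain ⟨t, ht, p, p', rfl, hqp, hp⟩ := hq
      exact ⟨Quotient.mk r₂ p, hST p ht, p, p', rfl,
        Quotient.sound (h _ _ (Quotient.exact hqp)), hp⟩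
  rintro x ⟨s, ⟨q, hq, rfl⟩, hs⟩
  refine ⟨Quotient.mk r₂ q, ⟨q, hq, rfl⟩, key x _ _ ?_ q hs⟩
  rintro p ⟨p', hp', hpp⟩
  exact ⟨p', hp', Quotient.sound (h _ _ (Quotient.exact hpp))⟩
end

section
/- Let M be a nondeterministic finite automaton over a finite alphabet α with finitely many states σ. An accepting run of M on a word w = [a₁, …, aₙ] is a sequence of states q₀, q₁, …, qₙ with q₀ in M's start set, qᵢ ∈ M.step q_{i-1} aᵢ for each 1 ≤ i ≤ n, and qₙ in M's accept set. Given a set T of words, define the projection automaton M|T over the same alphabet and state type: its start set consists of those states occurring as the initial state q₀ of some accepting run on some word of T, its accept set consists of those states occurring as the final state of some accepting run on some word of T, and its step set (M|T).step q a consists of those q' ∈ M.step q a such that the transition (q, a, q') occurs at some position of some accepting run on some word of T. Then there exists a finite set T of words, each accepted by M, such that M|T accepts exactly the same language as M. -/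
/-- An accepting run of an NFA `M` on a word `w = [a₁, …, aₙ]`: a sequence of
states `q₀, …, qₙ` with `q₀` a start state, `qᵢ ∈ M.step q_{i-1} aᵢ` for each
`1 ≤ i ≤ n`, and `qₙ` an accept state. -/
structure NFA.AccRun {α σ : Type*} (M : NFA α σ) (w : List α) where
  states : Fin (w.length + 1) → σ
  start_mem : states 0 ∈ M.start
  step_mem : ∀ i : Fin w.length, states i.succ ∈ M.step (states i.castSucc) (w.get i)
  accept_mem : states (Fin.last w.length) ∈ M.accept

/-- The language of words admitting an accepting run. -/
def NFA.runLang {α σ : Type*} (M : NFA α σ) : Set (List α) :=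
  {w | Nonempty (M.AccRun w)}

/-- The projection automaton `M|T` of an NFA `M` onto a set of words `T`:
its start (resp. accept) set consists of the states occurring as the initial
(resp. final) state of some accepting run on some word of `T`, and its step set
`(M|T).step q a` consists of those `q' ∈ M.step q a` such that the transition
`(q, a, q')` occurs at some position of some accepting run on some word of `T`. -/
def NFA.projection {α σ : Type*} (M : NFA α σ) (T : Set (List α)) : NFA α σ where
  start := {q | ∃ w ∈ T, ∃ ρ : M.AccRun w, ρ.states 0 = q}
  accept := {q | ∃ w ∈ T, ∃ ρ : M.AccRun w, ρ.states (Fin.last w.length) = q}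
  step q a := {q' | q' ∈ M.step q a ∧ ∃ w ∈ T, ∃ ρ : M.AccRun w, ∃ i : Fin w.length,
    ρ.states i.castSucc = q ∧ w.get i = a ∧ ρ.states i.succ = q'}

theorem finite_witnesses {ι β : Type*} [Finite ι] (P : ι → β → Prop) :
    ∃ T : Finset β, (∀ w ∈ T, ∃ i, P i w) ∧ ∀ i w, P i w → ∃ w' ∈ T, P i w' := by
  classical
  have hf : (Set.range (fun i : {i // ∃ w, P i w} => i.2.choose)).Finite := Set.finite_range _
  refine ⟨hf.toFinset, ?_, ?_⟩
  · intro w hw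
    rw [Set.Finite.mem_toFinset] at hw
    obtain ⟨i, rfl⟩ := hw
    exact ⟨i.1, i.2.choose_spec⟩
  · intro i w h
    have h' : ∃ w, P i w := ⟨w, h⟩
    refine ⟨h'.choose, ?_, h'.choose_spec⟩
    rw [Set.Finite.mem_toFinset]
    exact ⟨⟨i, h'⟩, rfl⟩

/-- Perfect projection (discrete skeleton): for any NFA over finite alphabet and
state set there is a finite set of words, each accepted by `M`, whose projection
automaton accepts exactly the same language as `M`. -/
theorem exists_finite_perfect_projection {α σ : Type*} [Fintype α] [Fintype σ]
    (M : NFA α σ) :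
    ∃ T : Finset (List α), ↑T ⊆ M.runLang ∧ (M.projection ↑T).runLang = M.runLang := by
  obtain ⟨T₁, a₁, b₁⟩ := finite_witnesses
    (fun (q : σ) w => ∃ ρ : M.AccRun w, ρ.states 0 = q)
  obtain ⟨T₂, a₂, b₂⟩ := finite_witnesses
    (fun (q : σ) w => ∃ ρ : M.AccRun w, ρ.states (Fin.last w.length) = q)
  obtain ⟨T₃, a₃, b₃⟩ := finite_witnesses
    (fun (t : σ × α × σ) w => ∃ ρ : M.AccRun w, ∃ i : Fin w.length,
      ρ.states i.castSucc = t.1 ∧ w.get i = t.2.1 ∧ ρ.states i.succ = t.2.2)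
  classical
  refine ⟨T₁ ∪ T₂ ∪ T₃, ?_, ?_⟩
  · intro w hw
    simp only [Finset.coe_union, Set.mem_union, Finset.mem_coe] at hw
    rcases hw with (hw | hw) | hw
    · obtain ⟨_, ρ, _⟩ := a₁ w hw
      exact ⟨ρ⟩
    · obtain ⟨_, ρ, _⟩ := a₂ w hw
      exact ⟨ρ⟩
    · obtain ⟨_, ρ, _⟩ := a₃ w hw
      exact ⟨ρ⟩
  · ext w
    constructor
    · rintro ⟨ρ⟩
      refine ⟨⟨ρ.states, ?_, fun i => (ρ.step_mem i).1, ?_⟩⟩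
      · obtain ⟨w', _, ρ', h⟩ := ρ.start_mem
        exact h ▸ ρ'.start_mem
      · obtain ⟨w', _, ρ', h⟩ := ρ.accept_mem
        exact h ▸ ρ'.accept_mem
    · rintro ⟨ρ⟩
      refine ⟨⟨ρ.states, ?_, fun i => ⟨ρ.step_mem i, ?_⟩, ?_⟩⟩
      · obtain ⟨w', hw, h⟩ := b₁ _ w ⟨ρ, rfl⟩
        exact ⟨w', by simp [hw], h⟩
      · obtain ⟨w', hw, h⟩ := b₃ (ρ.states i.castSucc, w.get i, ρ.states i.succ) w
          ⟨ρ, i, rfl, rfl, rfl⟩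
        exact ⟨w', by simp [hw], h⟩
      · obtain ⟨w', hw, h⟩ := b₂ _ w ⟨ρ, rfl⟩
        exact ⟨w', by simp [hw], h⟩
end
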